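/- Let α ≥ 2, 0 < r_1 < r_2, a > 0, g > 0, θ < 2, and for i ≠ j let V_{ij} ∈ C^1(ℝ^k ∖ {0}, ℝ) (independent of t) satisfy V_{ij}(ξ) = −a·m_i·m_j·|ξ|^{−α} for 0 < |ξ| < r_1 and V_{ij}(ξ) = g·m_i·m_j·|ξ|^θ for |ξ| ≥ r_2. Then with V(t, x_1,…,x_N) = (1/2) ∑_{i ≠ j} V_{ij}(x_i − x_j), there exists a sequence (X^n) of non-collision T-periodic solutions of ẍ_i + ∇_{x_i} V = 0, each satisfying x_i^n(t + T/2) = −x_i^n(t), with action values f(X^n) → +∞. -/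

import Mathlib

open MeasureTheory Filter

noncomputable section

/-- The total (autonomous) potential `V(x) = (1/2) ∑_{i ≠ j} V_{ij}(x_i - x_j)`. -/
def Vtot {N k : ℕ} (Vij : Fin N → Fin N → EuclideanSpace ℝ (Fin k) → ℝ)
    (x : Fin N → EuclideanSpace ℝ (Fin k)) : ℝ :=
  (1 / 2) * ∑ i, ∑ j, if i ≠ j then Vij i j (x i - x j) else 0

/-- The Lagrangian action of a `T`-periodic path (autonomous potential). -/
def action {N k : ℕ} (T : ℝ) (m : Fin N → ℝ)
    (Vij : Fin N → Fin N → EuclideanSpace ℝ (Fin k) → ℝ)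
    (X : ℝ → Fin N → EuclideanSpace ℝ (Fin k)) : ℝ :=
  (∑ i, m i / 2 * ∫ t in (0:ℝ)..T, ‖deriv (fun s => X s i) t‖ ^ 2)
    - ∫ t in (0:ℝ)..T, Vtot Vij (X t)

section PairEnergy

open Topology

lemma hasFDerivAt_norm_rpow_neg {E F : Type*} [NormedAddCommGroup E] [InnerProductSpace ℝ E]
    [NormedAddCommGroup F] [NormedSpace ℝ F]
    {f : F → E} {f' : F →L[ℝ] E} {y : F} (hf : HasFDerivAt f f' y) (h0 : f y ≠ 0) (α : ℝ) :
    HasFDerivAt (fun z => ‖f z‖ ^ (-α))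
      ((-α * ‖f y‖ ^ (-α - 2)) • (innerSL ℝ (f y)).comp f') y := by
  have hsq : ∀ (z : E) (s : ℝ), (‖z‖ ^ 2) ^ s = ‖z‖ ^ (2 * s) := fun z s => by
    rw [Real.rpow_mul (norm_nonneg z), Real.rpow_two]
  have h := hf.norm_sq.rpow_const (p := -α / 2) (Or.inl (by simpa using h0))
  convert h using 1
  · funext z
    rw [hsq]
    congr 1
    ring
  · rw [hsq, ← Nat.cast_smul_eq_nsmul ℝ, smul_smul]
    congr 1
    push_cast
    rw [show 2 * (-α / 2 - 1) = -α - 2 by ring]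
    ring

lemma pairEnergy_term_nonneg {ι E : Type*} [NormedAddCommGroup E] {c : ι → ι → ℝ}
    (hc : ∀ p q, 0 ≤ c p q) (α : ℝ) (x : ι → E) (p q : ι) [Decidable (p ≠ q)] :
    0 ≤ if p ≠ q then c p q * ‖x p - x q‖ ^ (-α) else 0 := by
  split_ifs
  · exact mul_nonneg (hc p q) (Real.rpow_nonneg (norm_nonneg _) _)
  · exact le_rfl

variable {ι E : Type*} [Fintype ι] [NormedAddCommGroup E]

/-- The repulsive homogeneous energy `(1/2) ∑_{p ≠ q} c_{pq} |x_p - x_q|^{-α}`. -/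
def pairEnergy [DecidableEq ι] (c : ι → ι → ℝ) (α : ℝ) (x : ι → E) : ℝ :=
  (1 / 2) * ∑ p, ∑ q, if p ≠ q then c p q * ‖x p - x q‖ ^ (-α) else 0

/-- The force on the `i`-th particle derived from `pairEnergy`, for symmetric coefficients. -/
def pairForce [InnerProductSpace ℝ E] (c : ι → ι → ℝ) (α : ℝ) (x : ι → E) (i : ι) : E :=
  ∑ q, (α * c i q * ‖x i - x q‖ ^ (-α - 2)) • (x i - x q)

variable [DecidableEq ι]

lemma pairEnergy_nonneg {c : ι → ι → ℝ} (hc : ∀ p q, 0 ≤ c p q) (α : ℝ) (x : ι → E) :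
    0 ≤ pairEnergy c α x :=
  mul_nonneg (by norm_num) (Finset.sum_nonneg fun p _ => Finset.sum_nonneg fun q _ =>
    pairEnergy_term_nonneg hc α x p q)

lemma le_pairEnergy {c : ι → ι → ℝ} (hc : ∀ p q, 0 ≤ c p q) (α : ℝ) (x : ι → E)
    {p q : ι} (hpq : p ≠ q) :
    c p q * ‖x p - x q‖ ^ (-α) ≤ 2 * pairEnergy c α x := by
  have h₁ := Finset.single_le_sum (fun j _ => pairEnergy_term_nonneg hc α x p j)
    (Finset.mem_univ q)
  have h₂ := Finset.single_le_sum
    (f := fun i => ∑ j, if i ≠ j then c i j * ‖x i - x j‖ ^ (-α) else 0)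
    (fun i _ => Finset.sum_nonneg fun j _ => pairEnergy_term_nonneg hc α x i j)
    (Finset.mem_univ p)
  rw [if_pos hpq] at h₁
  unfold pairEnergy
  linarith

lemma hasGradientAt_pairEnergy_update [InnerProductSpace ℝ E] [CompleteSpace E] {c : ι → ι → ℝ}
    (hc : ∀ p q, c p q = c q p) (α : ℝ) {x : ι → E} (hx : Function.Injective x) (i : ι) :
    HasGradientAt (fun y => pairEnergy c α (Function.update x i y)) (-pairForce c α x i)
      (x i) := by
  set D : ι → E →L[ℝ] E := Pi.single i (.id ℝ E)
  have hD : ∀ p, HasFDerivAt (fun y => Function.update x i y p) (D p) (x i) :=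
    hasFDerivAt_pi.1 (hasFDerivAt_update x (x i))
  have hterm : ∀ p q, HasFDerivAt
      (fun y => if p ≠ q then
        c p q * ‖Function.update x i y p - Function.update x i y q‖ ^ (-α) else 0)
      ((-α * c p q * ‖x p - x q‖ ^ (-α - 2)) • (innerSL ℝ (x p - x q)).comp (D p - D q))
      (x i) := by
    intro p q
    by_cases hpq : p = q
    · subst hpq
      simpa using hasFDerivAt_const (0 : ℝ) (x i)
    · have h := (hasFDerivAt_norm_rpow_neg ((hD p).sub (hD q))
        (by simpa [sub_eq_zero] using hx.ne hpq) α).const_mul (c p q)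
      simp only [Function.update_eq_self, Pi.sub_apply] at h
      simp only [ne_eq, hpq, not_false_eq_true, if_true]
      refine h.congr_fderiv ?_
      rw [smul_smul]
      congr 1
      ring
  have h := (HasFDerivAt.fun_sum (u := Finset.univ) fun p _ =>
    HasFDerivAt.fun_sum (u := Finset.univ) fun q _ => hterm p q).const_mul (1 / 2 : ℝ)
  rw [hasGradientAt_iff_hasFDerivAt]
  refine h.congr_fderiv ?_
  ext v
  have hDv : ∀ p, D p v = if p = i then v else 0 := fun p => by
    by_cases hp : p = i
    · subst hp; simp [D]
    · simp [D, hp]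
  have hswap : ∀ p, c p i * ‖x p - x i‖ ^ (-α - 2) * inner ℝ (x p - x i) v
      = -(c i p * ‖x i - x p‖ ^ (-α - 2) * inner ℝ (x i - x p) v) := fun p => by
    rw [hc p i, norm_sub_rev, ← neg_sub (x i) (x p), inner_neg_left]
    ring
  have hsplit : ∀ p q, -α * c p q * ‖x p - x q‖ ^ (-α - 2) * inner ℝ (x p - x q) (D p v - D q v)
      = (if p = i then -α * (c p q * ‖x p - x q‖ ^ (-α - 2) * inner ℝ (x p - x q) v) else 0)
        + if q = i then α * (c p q * ‖x p - x q‖ ^ (-α - 2) * inner ℝ (x p - x q) v) else 0 := by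
    intro p q
    rw [hDv, hDv, inner_sub_right]
    split_ifs <;> simp <;> ring
  simp only [pairForce, smul_apply, sum_apply,
    ContinuousLinearMap.comp_apply, sub_apply, innerSL_apply_apply,
    smul_eq_mul, hsplit, Finset.sum_add_distrib, Finset.sum_ite_eq', Finset.mem_univ, if_true,
    map_neg, neg_apply, InnerProductSpace.toDual_apply_apply, sum_inner,
    real_inner_smul_left]
  rw [Finset.sum_comm]
  simp only [Finset.sum_ite_eq', Finset.mem_univ, if_true, hswap, ← Finset.mul_sum,
    Finset.sum_neg_distrib, mul_assoc]
  ring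

lemma continuous_update_apply {ι E : Type*} [DecidableEq ι] [TopologicalSpace E] (x : ι → E)
    (i p : ι) : Continuous fun y => Function.update x i y p :=
  (continuous_apply p).comp ((continuous_const (y := x)).update i continuous_id)

lemma eventually_injective_update {ι E : Type*} [Finite ι] [DecidableEq ι] [TopologicalSpace E]
    [T2Space E] {x : ι → E} (hx : Function.Injective x) (i : ι) :
    ∀ᶠ y in 𝓝 (x i), Function.Injective (Function.update x i y) := by
  have hne : ∀ p r, p ≠ r →
      ∀ᶠ y in 𝓝 (x i), Function.update x i y p ≠ Function.update x i y r := fun p r hpr =>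
    ((isOpen_ne_fun (continuous_update_apply x i p) (continuous_update_apply x i r)).mem_nhds
      (by simpa using hx.ne hpr))
  have h := eventually_all.2 fun p => eventually_all.2 fun r =>
    eventually_imp_distrib_left.2 (hne p r)
  filter_upwards [h] with y hy p r hpr
  by_contra hpr'
  exact hy p r hpr' hpr

/-- A collinear central configuration: a critical point of `(1/2) ∑ q_i² + pairEnergy c α q`. -/
lemma exists_pairForce_eq_self {N : ℕ} {c : Fin N → Fin N → ℝ} (hpos : ∀ p q, 0 < c p q)
    (hc : ∀ p q, c p q = c q p) {α : ℝ} (hα : 0 < α) :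
    ∃ q : Fin N → ℝ, Function.Injective q ∧ ∀ i, pairForce c α q i = q i := by
  set F : (Fin N → ℝ) → ℝ := fun q => (1 / 2) * ∑ i, q i ^ 2 + pairEnergy c α q with hF
  have hc0 : ∀ p q, 0 ≤ c p q := fun p q => (hpos p q).le
  set q₀ : Fin N → ℝ := fun i => (i : ℝ)
  have hq₀ : Function.Injective q₀ := fun i j h => Fin.ext (by simpa [q₀] using h)
  set K : Set (Fin N → ℝ) :=
    {q | ∀ i, q i ^ 2 ≤ 2 * F q₀} ∩ {q | ∀ i j, i ≠ j → c i j ≤ 2 * F q₀ * ‖q i - q j‖ ^ α}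
  have hKinj : ∀ q ∈ K, Function.Injective q := by
    intro q hq i j hij
    by_contra hne
    have := hq.2 i j hne
    rw [hij, sub_self, norm_zero, Real.zero_rpow hα.ne', mul_zero] at this
    exact absurd (hpos i j) this.not_gt
  have hmem : ∀ q, Function.Injective q → F q ≤ F q₀ → q ∈ K := by
    intro q hq hle
    refine ⟨fun i => ?_, fun i j hij => ?_⟩
    · have h₁ := Finset.single_le_sum (f := fun i => q i ^ 2) (fun i _ => sq_nonneg (q i))
        (Finset.mem_univ i)
      have h₂ := pairEnergy_nonneg hc0 α q
      simp only [hF] at h₁ hle ⊢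
      linarith
    · have h₁ : 0 ≤ ∑ i, q i ^ 2 := Finset.sum_nonneg fun i _ => sq_nonneg (q i)
      have h₂ := le_pairEnergy hc0 α q hij
      have h₃ : c i j * ‖q i - q j‖ ^ (-α) ≤ 2 * F q₀ := by
        refine h₂.trans ?_
        simp only [hF] at hle ⊢
        linarith
      have hd : 0 < ‖q i - q j‖ := norm_pos_iff.2 (sub_ne_zero.2 (hq.ne hij))
      rwa [Real.rpow_neg hd.le, ← div_eq_mul_inv, div_le_iff₀ (Real.rpow_pos_of_pos hd α)] at h₃
  have hKclosed : IsClosed K := by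
    refine IsClosed.inter ?_ ?_
    · simp only [Set.ofPred_forall]
      exact isClosed_iInter fun i => isClosed_le (by fun_prop) continuous_const
    · simp only [Set.ofPred_forall]
      refine isClosed_iInter fun i => isClosed_iInter fun j => isClosed_iInter fun _ =>
        isClosed_le continuous_const (continuous_const.mul ?_)
      exact Continuous.rpow_const (by fun_prop) fun _ => Or.inr hα.le
  have hKcompact : IsCompact K := by
    refine Metric.isCompact_of_isClosed_isBounded hKclosed
      (Metric.isBounded_closedBall (x := 0) (r := √(2 * F q₀)) |>.subset
        fun (q : Fin N → ℝ) hq => ?_)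
    rw [mem_closedBall_zero_iff, pi_norm_le_iff_of_nonneg (Real.sqrt_nonneg _)]
    intro i
    exact Real.abs_le_sqrt (hq.1 i)
  have hFcont : ContinuousOn F K := by
    refine ContinuousOn.add (by fun_prop) (continuousOn_const.mul ?_)
    refine continuousOn_finsetSum _ fun i _ => continuousOn_finsetSum _ fun j _ => ?_
    by_cases hij : i = j
    · simpa [hij] using continuousOn_const
    · simp only [ne_eq, hij, not_false_eq_true, if_true]
      refine continuousOn_const.mul (ContinuousOn.rpow_const (by fun_prop) fun q hq => Or.inl ?_)
      exact norm_ne_zero_iff.2 (sub_ne_zero.2 ((hKinj q hq).ne hij))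
  obtain ⟨q, hqK, hqmin⟩ := hKcompact.exists_isMinOn ⟨q₀, hmem q₀ hq₀ le_rfl⟩ hFcont
  have hq := hKinj q hqK
  have hglobal : ∀ q', Function.Injective q' → F q ≤ F q' := by
    intro q' hq'
    rcases le_total (F q') (F q₀) with h | h
    · exact hqmin (hmem q' hq' h)
    · exact (hqmin (hmem q₀ hq₀ le_rfl)).trans h
  refine ⟨q, hq, fun i => ?_⟩
  have hinj := eventually_injective_update hq i
  have hloc : IsLocalMin (fun y => F (Function.update q i y)) (q i) := by
    filter_upwards [hinj] with y hy
    simpa using hglobal _ hy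
  have hsq : HasDerivAt (fun y => (1 / 2) * ∑ j, Function.update q i y j ^ 2) (q i) (q i) := by
    have h : ∀ j, HasDerivAt (fun y => Function.update q i y j ^ 2)
        (if j = i then 2 * q i else 0) (q i) := by
      intro j
      by_cases hj : j = i
      · subst hj
        simpa using hasDerivAt_pow 2 (q j)
      · simpa [hj] using hasDerivAt_const (q i) (q j ^ 2)
    have h' := (HasDerivAt.fun_sum (u := Finset.univ) fun j _ => h j).const_mul (1 / 2 : ℝ)
    simpa using h'
  have hder := hsq.add (hasGradientAt_pairEnergy_update hc α hq i).hasDerivAt'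
  have := hloc.hasDerivAt_eq_zero hder
  linarith

end PairEnergy

section Rotation

variable {E : Type*} [NormedAddCommGroup E] [InnerProductSpace ℝ E]

/-- The vector rotating with angular velocity `ω` in the oriented plane spanned by `e`, `f`. -/
def rotatingVector (e f : E) (ω t : ℝ) : E :=
  Real.cos (ω * t) • e + Real.sin (ω * t) • f

lemma norm_rotatingVector {e f : E} (he : ‖e‖ = 1) (hf : ‖f‖ = 1) (hef : inner ℝ e f = 0)
    (ω t : ℝ) : ‖rotatingVector e f ω t‖ = 1 := by
  have h : ‖rotatingVector e f ω t‖ * ‖rotatingVector e f ω t‖ = 1 := by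
    rw [rotatingVector, norm_add_sq_eq_norm_sq_add_norm_sq_real
      (by simp [real_inner_smul_left, real_inner_smul_right, hef]), norm_smul, norm_smul, he, hf,
      mul_one, mul_one, Real.norm_eq_abs, Real.norm_eq_abs, abs_mul_abs_self, abs_mul_abs_self]
    nlinarith [Real.sin_sq_add_cos_sq (ω * t)]
  nlinarith [norm_nonneg (rotatingVector e f ω t)]

lemma hasDerivAt_rotatingVector (e f : E) (ω t : ℝ) :
    HasDerivAt (rotatingVector e f ω) (ω • rotatingVector f (-e) ω t) t := by
  have h : HasDerivAt (fun s : ℝ => ω * s) ω t := by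
    simpa using (hasDerivAt_id t).const_mul ω
  refine ((h.cos.smul_const e).add (h.sin.smul_const f)).congr_deriv ?_
  simp only [rotatingVector]
  module

lemma contDiff_rotatingVector (e f : E) (ω : ℝ) {n : WithTop ℕ∞} :
    ContDiff ℝ n (rotatingVector e f ω) := by
  unfold rotatingVector
  fun_prop

lemma rotatingVector_add_half_turn (e f : E) {ω s : ℝ} {n : ℕ}
    (h : ω * s = (2 * n + 1) * Real.pi) (t : ℝ) :
    rotatingVector e f ω (t + s) = -rotatingVector e f ω t := by
  have h' : ω * (t + s) = ω * t + Real.pi + n * (2 * Real.pi) := by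
    rw [mul_add, h]
    ring
  simp only [rotatingVector, h', Real.cos_add_nat_mul_two_pi, Real.sin_add_nat_mul_two_pi,
    Real.cos_add_pi, Real.sin_add_pi]
  module

lemma deriv_smul_rotatingVector (b : ℝ) (e f : E) (ω t : ℝ) :
    deriv (fun s => b • rotatingVector e f ω s) t = (b * ω) • rotatingVector f (-e) ω t :=
  (((hasDerivAt_rotatingVector e f ω t).const_smul b).congr_deriv (smul_smul _ _ _)).deriv

lemma deriv_deriv_smul_rotatingVector (b : ℝ) (e f : E) (ω t : ℝ) :
    deriv (deriv fun s => b • rotatingVector e f ω s) t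
      = -((b * ω ^ 2) • rotatingVector e f ω t) := by
  rw [funext (deriv_smul_rotatingVector b e f ω), deriv_smul_rotatingVector]
  simp only [rotatingVector]
  module

end Rotation

section RelativeEquilibrium

open Topology

lemma Vtot_eq_neg_pairEnergy {N k : ℕ} {c : Fin N → Fin N → ℝ} {α r : ℝ}
    {Vij : Fin N → Fin N → EuclideanSpace ℝ (Fin k) → ℝ}
    (hV : ∀ i j, i ≠ j → ∀ ξ, ξ ≠ 0 → ‖ξ‖ < r → Vij i j ξ = -(c i j * ‖ξ‖ ^ (-α)))
    {x : Fin N → EuclideanSpace ℝ (Fin k)} (hx : Function.Injective x)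
    (hr : ∀ i j, ‖x i - x j‖ < r) :
    Vtot Vij x = -pairEnergy c α x := by
  rw [Vtot, pairEnergy, ← mul_neg, ← Finset.sum_neg_distrib]
  congr 1
  refine Finset.sum_congr rfl fun i _ => ?_
  rw [← Finset.sum_neg_distrib]
  refine Finset.sum_congr rfl fun j _ => ?_
  by_cases hij : i = j
  · simp [hij]
  · simpa [hij] using hV i j hij _ (sub_ne_zero.2 (hx.ne hij)) (hr i j)

lemma gradient_Vtot_update {N k : ℕ} {c : Fin N → Fin N → ℝ} (hc : ∀ i j, c i j = c j i)
    {α r : ℝ} {Vij : Fin N → Fin N → EuclideanSpace ℝ (Fin k) → ℝ}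
    (hV : ∀ i j, i ≠ j → ∀ ξ, ξ ≠ 0 → ‖ξ‖ < r → Vij i j ξ = -(c i j * ‖ξ‖ ^ (-α)))
    {x : Fin N → EuclideanSpace ℝ (Fin k)} (hx : Function.Injective x)
    (hr : ∀ i j, ‖x i - x j‖ < r) (i : Fin N) :
    gradient (fun y => Vtot Vij (Function.update x i y)) (x i) = pairForce c α x i := by
  have hnear : ∀ᶠ y in 𝓝 (x i),
      ∀ p q, ‖Function.update x i y p - Function.update x i y q‖ < r := by
    refine eventually_all.2 fun p => eventually_all.2 fun q => ?_
    refine ((continuous_update_apply x i p).sub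
      (continuous_update_apply x i q)).norm.continuousAt.eventually_lt continuousAt_const ?_
    simpa using hr p q
  have heq : (fun y => Vtot Vij (Function.update x i y))
      =ᶠ[𝓝 (x i)] fun y => -pairEnergy c α (Function.update x i y) := by
    filter_upwards [hnear, eventually_injective_update hx i] with y hy hinj
    exact Vtot_eq_neg_pairEnergy hV hinj hy
  rw [heq.gradient_eq]
  have h := (hasGradientAt_pairEnergy_update hc α hx i).hasFDerivAt.neg
  refine HasGradientAt.gradient ?_
  rw [hasGradientAt_iff_hasFDerivAt]
  refine h.congr_fderiv ?_
  simp

lemma pairForce_smul {N : ℕ} {E : Type*} [NormedAddCommGroup E] [InnerProductSpace ℝ E]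
    (c : Fin N → Fin N → ℝ) (α : ℝ) (q : Fin N → ℝ) {ρ : ℝ} (hρ : 0 < ρ) {u : E} (hu : ‖u‖ = 1)
    (i : Fin N) :
    pairForce c α (fun j => (ρ * q j) • u) i = (ρ ^ (-α - 1) * pairForce c α q i) • u := by
  have hpow : ρ ^ (-α - 1) = ρ ^ (-α - 2) * ρ := by
    rw [← Real.rpow_add_one hρ.ne']
    congr 1
    ring
  rw [pairForce, pairForce, Finset.mul_sum, Finset.sum_smul]
  refine Finset.sum_congr rfl fun j _ => ?_
  rw [← sub_smul, ← mul_sub, norm_smul, hu, mul_one, norm_mul, Real.norm_of_nonneg hρ.le,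
    Real.mul_rpow hρ.le (norm_nonneg _), hpow, smul_smul, smul_eq_mul]
  congr 1
  ring

end RelativeEquilibrium

theorem nbody_piecewise_potential_unbounded_actions
    {N k : ℕ} (hN : 2 ≤ N) (hk : 2 ≤ k)
    (T : ℝ) (hT : 0 < T)
    (m : Fin N → ℝ) (hm : ∀ i, 0 < m i)
    (α : ℝ) (hα : 2 ≤ α)
    (r₁ r₂ : ℝ) (hr₁ : 0 < r₁) (hr₁₂ : r₁ < r₂)
    (a g θ : ℝ) (ha : 0 < a) (hg : 0 < g) (hθ : θ < 2)
    (Vij : Fin N → Fin N → EuclideanSpace ℝ (Fin k) → ℝ)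
    -- each `V_{ij}` is `C¹` on `ℝ^k ∖ {0}` (independent of `t`)
    (hC1 : ∀ i j, i ≠ j →
      ContDiffOn ℝ 1 (Vij i j) {(0 : EuclideanSpace ℝ (Fin k))}ᶜ)
    -- `V_{ij}(ξ) = -a m_i m_j |ξ|^{-α}` for `0 < |ξ| < r₁`
    (hnear : ∀ i j, i ≠ j → ∀ ξ : EuclideanSpace ℝ (Fin k), ξ ≠ 0 → ‖ξ‖ < r₁ →
      Vij i j ξ = -(a * m i * m j * ‖ξ‖ ^ (-α)))
    -- `V_{ij}(ξ) = g m_i m_j |ξ|^{θ}` for `|ξ| ≥ r₂`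
    (hfar : ∀ i j, i ≠ j → ∀ ξ : EuclideanSpace ℝ (Fin k), r₂ ≤ ‖ξ‖ →
      Vij i j ξ = g * m i * m j * ‖ξ‖ ^ θ) :
    ∃ X : ℕ → ℝ → Fin N → EuclideanSpace ℝ (Fin k),
      (∀ n : ℕ,
        (∀ i, ContDiff ℝ 2 fun t => X n t i) ∧
        (∀ t i, X n (t + T) i = X n t i) ∧
        (∀ t i, X n (t + T / 2) i = -X n t i) ∧
        (∀ t, ∀ i j, i ≠ j → X n t i ≠ X n t j) ∧
        (∀ t i, deriv (deriv fun s => X n s i) t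
          + gradient (fun y => Vtot Vij (Function.update (X n t) i y)) (X n t i) = 0)) ∧
      Tendsto (fun n => action T m Vij (X n)) atTop atTop := by
  have hα0 : 0 < α := by linarith
  set c : Fin N → Fin N → ℝ := fun i j => a * m i * m j
  have hcpos : ∀ i j, 0 < c i j := fun i j => mul_pos (mul_pos ha (hm i)) (hm j)
  have hcsymm : ∀ i j, c i j = c j i := fun i j => by simp only [c]; ring
  obtain ⟨q, hqinj, hq⟩ := exists_pairForce_eq_self hcpos hcsymm hα0
  obtain ⟨e, f, he, hf, hef⟩ : ∃ e f : EuclideanSpace ℝ (Fin k),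
      ‖e‖ = 1 ∧ ‖f‖ = 1 ∧ inner ℝ e f = 0 := by
    refine ⟨EuclideanSpace.single ⟨0, by omega⟩ 1, EuclideanSpace.single ⟨1, by omega⟩ 1,
      ?_, ?_, ?_⟩
    · simp
    · simp
    · simp [EuclideanSpace.inner_single_left]
  set ω : ℕ → ℝ := fun n => (2 * n + 1) * Real.pi / (T / 2)
  have hω : ∀ n, 0 < ω n := fun n => by positivity
  have hωT : ∀ n, ω n * (T / 2) = (2 * n + 1) * Real.pi := fun n =>
    div_mul_cancel₀ _ (by positivity)
  have hωlim : Tendsto ω atTop atTop := by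
    refine Tendsto.atTop_div_const (by positivity) (Tendsto.atTop_mul_const Real.pi_pos ?_)
    exact tendsto_atTop_add_const_right _ _
      (tendsto_natCast_atTop_atTop.const_mul_atTop (by norm_num))
  set ρ : ℕ → ℝ := fun n => ω n ^ (-(2 / (α + 2)))
  have hρ : ∀ n, 0 < ρ n := fun n => Real.rpow_pos_of_pos (hω n) _
  have hρlim : Tendsto ρ atTop (nhds 0) :=
    (tendsto_rpow_neg_atTop (by positivity)).comp hωlim
  have hbal : ∀ n, ρ n ^ (-α - 1) = ρ n * ω n ^ 2 := fun n => by
    simp only [ρ]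
    rw [← Real.rpow_mul (hω n).le, ← Real.rpow_two, ← Real.rpow_add (hω n)]
    congr 1
    field_simp
    ring
  set Y : ℕ → ℝ → Fin N → EuclideanSpace ℝ (Fin k) :=
    fun n t i => (ρ n * q i) • rotatingVector e f (ω n) t with hY
  have hu : ∀ n t, ‖rotatingVector e f (ω n) t‖ = 1 := fun n => norm_rotatingVector he hf hef (ω n)
  have hYdist : ∀ n t i j, ‖Y n t i - Y n t j‖ = ρ n * |q i - q j| := fun n t i j => by
    simp only [hY]
    rw [← sub_smul, ← mul_sub, norm_smul, hu, mul_one, norm_mul, Real.norm_of_nonneg (hρ n).le,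
      Real.norm_eq_abs]
  have hYinj : ∀ n t, Function.Injective (Y n t) := fun n t i j hij => by
    have h := hYdist n t i j
    rw [hij, sub_self, norm_zero, eq_comm, mul_eq_zero, abs_eq_zero, sub_eq_zero] at h
    exact hqinj (h.resolve_left (hρ n).ne')
  have hhalf : ∀ n t i, Y n (t + T / 2) i = -Y n t i := fun n t i => by
    simp only [hY, rotatingVector_add_half_turn e f (hωT n), smul_neg]
  obtain ⟨n₀, hn₀⟩ : ∃ n₀, ∀ n ≥ n₀, ∀ i j, ρ n * |q i - q j| < r₁ := by
    refine eventually_atTop.1 (eventually_all.2 fun i => eventually_all.2 fun j => ?_)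
    exact (hρlim.mul_const |q i - q j|).eventually_lt_const (by simpa using hr₁)
  have hsmall : ∀ n t i j, ‖Y (n + n₀) t i - Y (n + n₀) t j‖ < r₁ := fun n t i j => by
    rw [hYdist]
    exact hn₀ _ (Nat.le_add_left _ _) i j
  refine ⟨fun n => Y (n + n₀), fun n => ⟨fun i => ?_, fun t i => ?_, fun t i => hhalf _ t i,
    fun t i j hij => (hYinj _ t).ne hij, fun t i => ?_⟩, ?_⟩
  · exact (contDiff_rotatingVector e f _).const_smul _
  · change Y (n + n₀) (t + T) i = Y (n + n₀) t i
    rw [show t + T = t + T / 2 + T / 2 by ring, hhalf, hhalf, neg_neg]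
  · rw [gradient_Vtot_update hcsymm hnear (hYinj _ t) (hsmall n t)]
    simp only [hY]
    rw [deriv_deriv_smul_rotatingVector, pairForce_smul c α q (hρ _) (hu _ t), hq, hbal,
      neg_add_eq_zero]
    congr 1
    ring
  · obtain ⟨i₀, hi₀⟩ : ∃ i, q i ≠ 0 := by
      by_contra! h
      have := hqinj ((h ⟨0, by omega⟩).trans (h ⟨1, by omega⟩).symm)
      simp at this
    have hkin : ∀ n i, ∫ t in (0:ℝ)..T, ‖deriv (fun s => Y n s i) t‖ ^ 2
        = T * (q i ^ 2 * (ρ n * ω n) ^ 2) := fun n i => by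
      have h : ∀ t, ‖deriv (fun s => Y n s i) t‖ ^ 2 = q i ^ 2 * (ρ n * ω n) ^ 2 := fun t => by
        simp only [hY]
        rw [deriv_smul_rotatingVector, norm_smul,
          norm_rotatingVector hf (by rwa [norm_neg])
            (by rw [inner_neg_right, real_inner_comm, hef, neg_zero]),
          mul_one, Real.norm_eq_abs, sq_abs]
        ring
      simp only [h, intervalIntegral.integral_const, sub_zero, smul_eq_mul]
    have hpot : ∀ n, ∫ t in (0:ℝ)..T, Vtot Vij (Y (n + n₀) t) ≤ 0 := fun n => by
      rw [← neg_nonneg, ← intervalIntegral.integral_neg]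
      refine intervalIntegral.integral_nonneg hT.le fun t _ => ?_
      rw [Vtot_eq_neg_pairEnergy hnear (hYinj _ t) (hsmall n t), neg_neg]
      exact pairEnergy_nonneg (fun i j => (hcpos i j).le) α _
    have hlow : ∀ n, m i₀ / 2 * (T * q i₀ ^ 2) * (ρ (n + n₀) * ω (n + n₀)) ^ 2
        ≤ action T m Vij (Y (n + n₀)) := fun n => by
      have h := Finset.single_le_sum
        (f := fun i => m i / 2 * (T * (q i ^ 2 * (ρ (n + n₀) * ω (n + n₀)) ^ 2)))
        (fun i _ => by have := hm i; positivity) (Finset.mem_univ i₀)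
      simp only [action, hkin]
      have := hpot n
      linarith
    have hspeed : Tendsto (fun n => ρ n * ω n) atTop atTop := by
      have hexp : 0 < 1 - 2 / (α + 2) := by
        rw [sub_pos, div_lt_one (by positivity)]
        linarith
      refine ((tendsto_rpow_atTop hexp).comp hωlim).congr fun n => ?_
      simp only [Function.comp, ρ]
      rw [← Real.rpow_add_one (hω n).ne']
      congr 1
      ring
    refine tendsto_atTop_mono hlow (Tendsto.const_mul_atTop ?_ ?_)
    · have := hm i₀
      positivity
    · exact (tendsto_pow_atTop two_ne_zero).comp ((tendsto_add_atTop_iff_nat n₀).2 hspeed)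

end
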